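/- arXiv:2604.03729 — 9 statements merged into one kernel-verified Lean document; each statement's English description precedes it below -/
import Mathlib

section
/- (Busch–Singh, two-outcome case.) Let T and S be effects on a complex Hilbert space H. Then √T ∘ S ∘ √T + √(1 − T) ∘ S ∘ √(1 − T) = S if and only if T ∘ S = S ∘ T. -/
set_option synthInstance.maxHeartbeats 1000000
set_option maxHeartbeats 1000000

noncomputable section

/-- An additive isometry that fixes the displacement `f x - x` fixes `x`. -/
theorem AddMonoidHom.map_eq_self_of_map_sub_eq {E : Type*} [NormedAddCommGroup E] [NormedSpace ℝ E]
    (f : E →+ E) (hf : ∀ x, ‖f x‖ = ‖x‖) {x : E} (hx : f (f x - x) = f x - x) : f x = x := by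
  have iterate_eq (n : ℕ) : f^[n] x = x + n • (f x - x) := by
    induction n with
    | zero => simp
    | succ n ih =>
      rw [Function.iterate_succ_apply', ih, map_add, map_nsmul, hx, succ_nsmul]
      abel
  have norm_iterate (n : ℕ) : ‖f^[n] x‖ = ‖x‖ := by
    induction n with
    | zero => rfl
    | succ n ih => rw [Function.iterate_succ_apply', hf, ih]
  have bound (n : ℕ) : n • ‖f x - x‖ ≤ 2 * ‖x‖ := by
    rw [← RCLike.norm_nsmul ℝ, ← sub_eq_of_eq_add' (iterate_eq n)]
    linarith [norm_sub_le (f^[n] x) x, norm_iterate n]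
  by_contra hne
  obtain ⟨n, hn⟩ := exists_lt_nsmul (norm_pos_iff.mpr (sub_ne_zero.mpr hne)) (2 * ‖x‖)
  exact (bound n).not_gt hn

/-- If `x` is the mean of its conjugates by a unitary `u` and by `star u`, then `u` commutes
with `x`. -/
theorem commute_of_unitary_conj_add_conj_eq {A : Type*} [NormedRing A] [StarRing A] [CStarRing A]
    [NormedSpace ℝ A] {u : A} (hu : u ∈ unitary A) {x : A}
    (h : u * x * star u + star u * x * u = x + x) : Commute u x := by
  have huu : star u * u = 1 := Unitary.star_mul_self_of_mem hu
  have huu' : u * star u = 1 := Unitary.mul_star_self_of_mem hu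
  let f : A →+ A := (AddMonoidHom.mulRight (star u)).comp (AddMonoidHom.mulLeft u)
  have f_apply (y : A) : f y = u * y * star u := rfl
  have hfix : u * x * star u = x := by
    refine f.map_eq_self_of_map_sub_eq (fun y ↦ ?_) ?_
    · rw [f_apply, CStarRing.norm_mul_mem_unitary _ (Unitary.star_mem hu),
        CStarRing.norm_mem_unitary_mul _ hu]
    · have hinv : f (star u * x * u) = x := by
        rw [f_apply, ← mul_assoc, ← mul_assoc, huu', one_mul, mul_assoc, huu', mul_one]
      have hf := congrArg f h
      rw [← f_apply, map_add, map_add, hinv] at hf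
      rw [map_sub, sub_eq_sub_iff_add_eq_add, hf]
  calc u * x = u * x * (star u * u) := by rw [huu, mul_one]
    _ = u * x * star u * u := by rw [mul_assoc _ (star u)]
    _ = x * u := by rw [hfix]

open Complex in
/-- Commuting self-adjoint `a`, `b` with `a * a + b * b = 1` are the Kraus operators of a map whose
fixed points commute with `a`. -/
theorem commute_of_conj_add_conj_eq_self {A : Type*} [CStarAlgebra A] {a b x : A}
    (ha : IsSelfAdjoint a) (hb : IsSelfAdjoint b) (hab : Commute a b) (hsum : a * a + b * b = 1)
    (h : a * x * a + b * x * b = x) : Commute a x := by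
  have hstar : star (a + I • b) = a - I • b := by
    simp [ha.star_eq, hb.star_eq, sub_eq_add_neg]
  have hu : a + I • b ∈ unitary A := by
    rw [Unitary.mem_iff, hstar, ← hsum]
    constructor <;>
    · simp only [add_mul, sub_mul, mul_add, mul_sub, smul_mul_assoc, mul_smul_comm, smul_add, smul_sub,
        smul_smul, I_mul_I, hab.eq]
      module
  have hux : Commute (a + I • b) x := by
    refine commute_of_unitary_conj_add_conj_eq hu ?_
    rw [hstar]
    nth_rw 3 4 [← h]
    simp only [add_mul, sub_mul, mul_add, mul_sub, smul_mul_assoc, mul_smul_comm, smul_add, smul_sub,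
      smul_smul, I_mul_I]
    module
  have hux' : Commute (star (a + I • b)) x := by
    have huu : star (a + I • b) * (a + I • b) = 1 := Unitary.star_mul_self_of_mem hu
    have huu' : (a + I • b) * star (a + I • b) = 1 := Unitary.mul_star_self_of_mem hu
    exact Commute.units_inv_left (u := ⟨_, _, huu', huu⟩) hux
  have hreal : a = (2⁻¹ : ℂ) • ((a + I • b) + star (a + I • b)) := by
    rw [hstar]
    module
  rw [hreal]
  exact (hux.add_left hux').smul_left _

/-- **Busch–Singh, two-outcome case.** For effects `T`, `S` on a complex Hilbert space,
the Heisenberg no-signaling identity for a non-selective Lüders measurement of the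
two-outcome POVM `{T, 1 − T}` holds against `S` iff `T` and `S` commute. -/
theorem busch_singh_two_outcome
    {H : Type*} [NormedAddCommGroup H] [InnerProductSpace ℂ H] [CompleteSpace H]
    (T S : H →L[ℂ] H)
    (hT0 : 0 ≤ T) (hT1 : T ≤ 1) (hS0 : 0 ≤ S) (hS1 : S ≤ 1) :
    CFC.sqrt T * S * CFC.sqrt T + CFC.sqrt (1 - T) * S * CFC.sqrt (1 - T) = S ↔
      T * S = S * T := by
  have hsT : CFC.sqrt T * CFC.sqrt T = T := CFC.sqrt_mul_sqrt_self T hT0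
  have hsT' : CFC.sqrt (1 - T) * CFC.sqrt (1 - T) = 1 - T :=
    CFC.sqrt_mul_sqrt_self (1 - T) (sub_nonneg.mpr hT1)
  constructor
  · intro h
    have hT : Commute T (1 - T) := (Commute.one_right T).sub_right (Commute.refl T)
    have hab : Commute (CFC.sqrt T) (CFC.sqrt (1 - T)) :=
      ((hT.cfcₙ_nnreal NNReal.sqrt).symm.cfcₙ_nnreal NNReal.sqrt).symm
    have hcomm := commute_of_conj_add_conj_eq_self (CFC.sqrt_nonneg T).isSelfAdjoint
      (CFC.sqrt_nonneg (1 - T)).isSelfAdjoint hab (by rw [hsT, hsT']; abel) h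
    rw [← hsT]
    exact (hcomm.mul_left hcomm).eq
  · intro h
    have hTS : Commute T S := h
    have h₁ : Commute (CFC.sqrt T) S := hTS.cfcₙ_nnreal NNReal.sqrt
    have h₂ : Commute (CFC.sqrt (1 - T)) S :=
      ((Commute.one_left S).sub_left hTS).cfcₙ_nnreal NNReal.sqrt
    rw [h₁.eq, h₂.eq, mul_assoc, mul_assoc, hsT, hsT', ← mul_add, add_sub_cancel, mul_one]

end
end

section
/- (Busch–Singh, discrete-spectrum case.) Let T₁, …, T_N be a finite discrete POVM on a complex Hilbert space H, and let S be an effect on H for which there exist an orthonormal Hilbert basis (e_n)_{n ∈ ℕ} of H and a nonincreasing sequence (λ_n)_{n ∈ ℕ} of reals with S e_n = λ_n e_n for all n. Then ∑_{j=1}^{N} √T_j ∘ S ∘ √T_j = S if and only if T_j ∘ S = S ∘ T_j for every j. -/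
set_option synthInstance.maxHeartbeats 1000000
set_option maxHeartbeats 1000000

noncomputable section

section

open scoped InnerProductSpace

variable {H : Type*} [NormedAddCommGroup H] [InnerProductSpace ℂ H]

/-- A symmetric operator diagonalized by a Hilbert basis acts on coordinates by multiplication
by its eigenvalues. -/
lemma inner_hilbertBasis_apply_of_isSymmetric {ι : Type*} (e : HilbertBasis ι ℂ H) {μ : ι → ℝ}
    {S : H →L[ℂ] H} (hS : (S : H →ₗ[ℂ] H).IsSymmetric) (hSe : ∀ n, S (e n) = (μ n : ℂ) • e n)
    (n : ι) (x : H) : ⟪e n, S x⟫_ℂ = μ n * ⟪e n, x⟫_ℂ := by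
  rw [← ContinuousLinearMap.coe_coe S, ← hS, ContinuousLinearMap.coe_coe, hSe, inner_smul_left,
    Complex.conj_ofReal]

/-- The quadratic form of `c • 1 - S`, for `S` diagonalized by a Hilbert basis. -/
lemma hasSum_sub_eigenvalue_mul_norm_inner_sq {ι : Type*} (e : HilbertBasis ι ℂ H) {μ : ι → ℝ}
    {S : H →L[ℂ] H} (hS : (S : H →ₗ[ℂ] H).IsSymmetric) (hSe : ∀ n, S (e n) = (μ n : ℂ) • e n)
    (c : ℝ) (x : H) :
    HasSum (fun n ↦ (c - μ n) * ‖⟪e n, x⟫_ℂ‖ ^ 2) (c * ‖x‖ ^ 2 - (⟪x, S x⟫_ℂ).re) := by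
  convert! Complex.hasSum_re (e.hasSum_inner_mul_inner x ((c : ℂ) • x - S x)) using 1
  · ext n
    rw [inner_sub_right, inner_smul_right, inner_hilbertBasis_apply_of_isSymmetric e hS hSe,
      ← sub_mul, mul_left_comm, ← inner_conj_symm x (e n), Complex.conj_mul']
    norm_cast
  · rw [inner_sub_right, inner_smul_right, Complex.sub_re, Complex.re_ofReal_mul]
    congr 2
    exact (inner_self_eq_norm_sq (𝕜 := ℂ) x).symm

/-- If `S` has nonincreasing eigenvalues and is fixed by the unital map `X ↦ ∑ j, A j * X * A j`
with symmetric `A j`, then the `A j` have no matrix elements between different eigenspaces. -/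
lemma inner_apply_eq_zero_of_sum_mul_mul_eq {ι : Type*} [Fintype ι] {A : ι → H →L[ℂ] H}
    (hA : ∀ j, (A j : H →ₗ[ℂ] H).IsSymmetric) (hA1 : ∑ j, A j * A j = 1)
    {S : H →L[ℂ] H} (hS : (S : H →ₗ[ℂ] H).IsSymmetric)
    (e : HilbertBasis ℕ ℂ H) {μ : ℕ → ℝ} (hμ : Antitone μ)
    (hSe : ∀ n, S (e n) = (μ n : ℂ) • e n) (h : ∑ j, A j * S * A j = S) (n : ℕ) :
    ∀ j k, μ k ≠ μ n → ⟪e k, A j (e n)⟫_ℂ = 0 := by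
  have hA' (j) (x y : H) : ⟪A j x, y⟫_ℂ = ⟪x, A j y⟫_ℂ := hA j x y
  induction n using Nat.strong_induction_on with
  | _ n ih =>
    have hlt (j k) (hk : μ n < μ k) : ⟪e k, A j (e n)⟫_ℂ = 0 := by
      rw [← hA', inner_eq_zero_symm]
      exact ih k (lt_of_not_ge fun hnk ↦ (hμ hnk).not_gt hk) j n hk.ne
    have hpos (j k) : 0 ≤ (μ n - μ k) * ‖⟪e k, A j (e n)⟫_ℂ‖ ^ 2 := by
      rcases lt_or_ge (μ n) (μ k) with hk | hk
      · simp [hlt j k hk]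
      · exact mul_nonneg (sub_nonneg.2 hk) (sq_nonneg _)
    have hsum (j) := hasSum_sub_eigenvalue_mul_norm_inner_sq e hS hSe (μ n) (A j (e n))
    have hnorm : ∑ j, ‖A j (e n)‖ ^ 2 = 1 := by
      have := congrArg (fun X : H →L[ℂ] H ↦ (⟪e n, X (e n)⟫_ℂ).re) hA1
      simpa [sum_apply, inner_sum, ← hA', inner_self_eq_norm_sq_to_K, e.orthonormal.1 n,
        ← Complex.ofReal_pow] using this
    have hquad : ∑ j, (⟪A j (e n), S (A j (e n))⟫_ℂ).re = μ n := by
      have := congrArg (fun X : H →L[ℂ] H ↦ (⟪e n, X (e n)⟫_ℂ).re) h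
      simpa [sum_apply, inner_sum, ← hA', hSe, inner_smul_right,
        e.orthonormal.1 n]
        using this
    have htotal : ∑ j, (μ n * ‖A j (e n)‖ ^ 2 - (⟪A j (e n), S (A j (e n))⟫_ℂ).re) = 0 := by
      rw [Finset.sum_sub_distrib, ← Finset.mul_sum, hnorm, hquad, mul_one, sub_self]
    intro j k hk
    have hj := (Finset.sum_eq_zero_iff_of_nonneg fun j _ ↦ (hsum j).nonneg (hpos j)).1 htotal j
      (Finset.mem_univ j)
    have hjk := congrFun ((hasSum_zero_iff_of_nonneg (hpos j)).1 (hj ▸ hsum j)) k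
    simpa [sub_eq_zero, hk.symm] using hjk

/-- An operator without matrix elements between different eigenspaces of a diagonalized
symmetric operator `S` commutes with `S`. -/
lemma commute_of_inner_apply_eq_zero {ι : Type*} (e : HilbertBasis ι ℂ H) {μ : ι → ℝ}
    {A S : H →L[ℂ] H} (hS : (S : H →ₗ[ℂ] H).IsSymmetric)
    (hSe : ∀ n, S (e n) = (μ n : ℂ) • e n)
    (h : ∀ n k, μ k ≠ μ n → ⟪e k, A (e n)⟫_ℂ = 0) : Commute A S := by
  refine ContinuousLinearMap.ext_on
    (Submodule.dense_iff_topologicalClosure_eq_top.2 e.dense_span) ?_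
  rintro _ ⟨n, rfl⟩
  refine e.repr.injective (lp.ext (funext fun k ↦ ?_))
  rw [e.repr_apply_apply, e.repr_apply_apply, mul_apply_eq_comp,
    mul_apply_eq_comp, hSe, map_smul, inner_smul_right,
    inner_hilbertBasis_apply_of_isSymmetric e hS hSe]
  by_cases hk : μ k = μ n
  · rw [hk]
  · rw [h n k hk, mul_zero, mul_zero]

end

/-- **Busch–Singh, discrete-spectrum case.** Let `T₁, …, T_N` be a finite discrete POVM
and let `S` be an effect diagonalized by an orthonormal Hilbert basis `(e n)` with a
nonincreasing sequence of (real) eigenvalues `μ n`. Then the Heisenberg no-signaling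
identity for a non-selective Lüders measurement of `T` holds against `S` iff every `T j`
commutes with `S`. -/
theorem busch_singh_discrete_spectrum
    {H : Type*} [NormedAddCommGroup H] [InnerProductSpace ℂ H] [CompleteSpace H]
    (N : ℕ) (T : Fin N → (H →L[ℂ] H))
    (hT0 : ∀ j, 0 ≤ T j) (hT1 : ∀ j, T j ≤ 1) (hTsum : ∑ j, T j = 1)
    (S : H →L[ℂ] H) (hS0 : 0 ≤ S) (hS1 : S ≤ 1)
    (e : HilbertBasis ℕ ℂ H) (μ : ℕ → ℝ) (hμ : Antitone μ)
    (hSe : ∀ n : ℕ, S (e n) = (μ n : ℂ) • (e n : H)) :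
    (∑ j, CFC.sqrt (T j) * S * CFC.sqrt (T j)) = S ↔ ∀ j, T j * S = S * T j := by
  have hsq (j) : CFC.sqrt (T j) * CFC.sqrt (T j) = T j := CFC.sqrt_mul_sqrt_self (T j) (hT0 j)
  have hsym {X : H →L[ℂ] H} (hX : 0 ≤ X) : (X : H →ₗ[ℂ] H).IsSymmetric :=
    ((ContinuousLinearMap.nonneg_iff_isPositive X).1 hX).isSymmetric
  constructor
  · intro h j
    have hcomm : Commute (CFC.sqrt (T j)) S :=
      commute_of_inner_apply_eq_zero e (hsym hS0) hSe fun n ↦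
        inner_apply_eq_zero_of_sum_mul_mul_eq (fun j ↦ hsym (CFC.sqrt_nonneg (T j)))
          (by simp_rw [hsq, hTsum]) (hsym hS0) e hμ hSe h n j
    rw [← hsq j]
    exact hcomm.mul_left hcomm
  · intro h
    have hcomm (j) : Commute (CFC.sqrt (T j)) S := Commute.cfcₙ_nnreal (h j) _
    simp_rw [fun j ↦ (hcomm j).eq, mul_assoc, hsq, ← Finset.mul_sum, hTsum, mul_one]

end
end

section
/- (Relativistic consistency versus commutativity for Lüders measurements.) Let T₁, …, T_N and S₁, …, S_M be two finite discrete POVMs on a complex Hilbert space H. Then √T_j ∘ S_i ∘ √T_j = √S_i ∘ T_j ∘ √S_i holds for all i ∈ {1,…,M} and j ∈ {1,…,N} if and only if T_j ∘ S_i = S_i ∘ T_j for all i, j. -/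
set_option synthInstance.maxHeartbeats 1000000
set_option maxHeartbeats 1000000

noncomputable section

section CStarAlgebra

variable {A : Type*} [CStarAlgebra A]

/-- If `a` and `b` are self-adjoint and `a * b` is normal, then `a * a` commutes with `b`. -/
lemma IsSelfAdjoint.commute_mul_self_of_mul_mul_eq {a b : A} (ha : IsSelfAdjoint a)
    (hb : IsSelfAdjoint b) (h : a * (b * b) * a = b * (a * a) * b) : Commute (a * a) b := by
  have hab : star (a * b) = b * a := by rw [star_mul, ha.star_eq, hb.star_eq]
  have hba : star (b * a) = a * b := by rw [star_mul, ha.star_eq, hb.star_eq]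
  have hnormal : IsStarNormal (a * b) := by
    refine ⟨?_⟩
    rw [hab, commute_iff_eq]
    simpa only [mul_assoc] using h.symm
  have hsemi : SemiconjBy a (b * a) (a * b) := (mul_assoc a b a).symm
  have hstar := hsemi.star_right (hab ▸ hnormal.star) hnormal
  rw [hab, hba] at hstar
  simpa only [SemiconjBy, Commute, mul_assoc] using hstar.eq

variable [PartialOrder A] [StarOrderedRing A]

/-- Two nonnegative elements commute iff their sequential products in either order agree. -/
lemma CFC.sqrt_mul_mul_sqrt_eq_iff_commute {s t : A} (hs : 0 ≤ s) (ht : 0 ≤ t) :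
    CFC.sqrt t * s * CFC.sqrt t = CFC.sqrt s * t * CFC.sqrt s ↔ Commute t s := by
  have hs2 := CFC.sqrt_mul_sqrt_self s hs
  have ht2 := CFC.sqrt_mul_sqrt_self t ht
  constructor
  · intro h
    have hcomm := (CFC.sqrt_nonneg t).isSelfAdjoint.commute_mul_self_of_mul_mul_eq
      (CFC.sqrt_nonneg s).isSelfAdjoint (by rwa [hs2, ht2])
    rw [ht2] at hcomm
    exact hs2 ▸ hcomm.mul_right hcomm
  · intro h
    have hts : Commute (CFC.sqrt t) s := h.cfcₙ_nnreal _
    have hst : Commute (CFC.sqrt s) t := h.symm.cfcₙ_nnreal _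
    rw [hts.eq, hst.eq, mul_assoc, mul_assoc, hs2, ht2, h.eq]

end CStarAlgebra

/-- **Relativistic consistency versus commutativity for Lüders measurements.**
For two finite discrete POVMs `T₁, …, T_N` and `S₁, …, S_M`, the Heisenberg form of the
relativistic consistency condition `√T_j S_i √T_j = √S_i T_j √S_i` (for all `i`, `j`)
holds iff all effects commute: `T_j S_i = S_i T_j` for all `i`, `j`. -/
theorem relativistic_consistency_iff_commutativity_Lueders
    {H : Type*} [NormedAddCommGroup H] [InnerProductSpace ℂ H] [CompleteSpace H]
    (N M : ℕ) (T : Fin N → (H →L[ℂ] H)) (S : Fin M → (H →L[ℂ] H))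
    (hT0 : ∀ j, 0 ≤ T j) (hT1 : ∀ j, T j ≤ 1) (hTsum : ∑ j, T j = 1)
    (hS0 : ∀ i, 0 ≤ S i) (hS1 : ∀ i, S i ≤ 1) (hSsum : ∑ i, S i = 1) :
    (∀ i : Fin M, ∀ j : Fin N,
        CFC.sqrt (T j) * S i * CFC.sqrt (T j) = CFC.sqrt (S i) * T j * CFC.sqrt (S i)) ↔
      (∀ i : Fin M, ∀ j : Fin N, T j * S i = S i * T j) := by
  exact forall₂_congr fun i j => CFC.sqrt_mul_mul_sqrt_eq_iff_commute (hS0 i) (hT0 j)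

end
end

section
/- (Relativistic consistency implies commutativity for efficient measurements with self-adjoint Kraus operators.) Let T₁, …, T_N and S₁, …, S_M be two finite discrete POVMs on a complex Hilbert space H, and let K₁, …, K_N and L₁, …, L_M be self-adjoint bounded operators on H with K_j ∘ K_j = T_j for every j and L_i ∘ L_i = S_i for every i. If K_j ∘ S_i ∘ K_j = L_i ∘ T_j ∘ L_i for all i ∈ {1,…,M} and j ∈ {1,…,N}, then T_j ∘ S_i = S_i ∘ T_j for all i, j. -/
set_option synthInstance.maxHeartbeats 1000000
set_option maxHeartbeats 1000000

noncomputable section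

/-- If `a` and `b` are self-adjoint elements of a C⋆-algebra whose product is normal, then `a * a`
commutes with `b`. -/
theorem IsSelfAdjoint.commute_mul_self_of_isStarNormal_mul {A : Type*} [NonUnitalCStarAlgebra A]
    {a b : A} (ha : IsSelfAdjoint a) (hb : IsSelfAdjoint b) (hab : IsStarNormal (a * b)) :
    Commute (a * a) b := by
  have hstar : star (a * b) = b * a := by rw [star_mul, ha.star_eq, hb.star_eq]
  have hba : IsStarNormal (b * a) := hstar ▸ hab.star
  have h : SemiconjBy a (b * a) (a * b) := (mul_assoc a b a).symm
  have h' := h.star_right hba hab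
  rw [← hstar, star_star, hstar] at h'
  simpa only [Commute, SemiconjBy, mul_assoc] using h'.eq

/-- **Relativistic consistency implies commutativity for efficient measurements with
self-adjoint Kraus operators.** If `K_j` and `L_i` are self-adjoint with `K_j² = T_j`,
`L_i² = S_i`, and `K_j S_i K_j = L_i T_j L_i` for all `i`, `j`, then all the effects
commute. -/
theorem relativistic_consistency_implies_commutativity_selfadjoint_kraus
    {H : Type*} [NormedAddCommGroup H] [InnerProductSpace ℂ H] [CompleteSpace H]
    (N M : ℕ) (T : Fin N → (H →L[ℂ] H)) (S : Fin M → (H →L[ℂ] H))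
    (hT0 : ∀ j, 0 ≤ T j) (hT1 : ∀ j, T j ≤ 1) (hTsum : ∑ j, T j = 1)
    (hS0 : ∀ i, 0 ≤ S i) (hS1 : ∀ i, S i ≤ 1) (hSsum : ∑ i, S i = 1)
    (K : Fin N → (H →L[ℂ] H)) (L : Fin M → (H →L[ℂ] H))
    (hKsa : ∀ j, IsSelfAdjoint (K j)) (hLsa : ∀ i, IsSelfAdjoint (L i))
    (hKT : ∀ j, K j * K j = T j) (hLS : ∀ i, L i * L i = S i)
    (hRCC : ∀ i : Fin M, ∀ j : Fin N, K j * S i * K j = L i * T j * L i) :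
    ∀ i : Fin M, ∀ j : Fin N, T j * S i = S i * T j := by
  intro i j
  have hnormal : IsStarNormal (K j * L i) := by
    refine ⟨?_⟩
    have h := hRCC i j
    rw [← hLS, ← hKT] at h
    rw [commute_iff_eq, star_mul, (hKsa j).star_eq, (hLsa i).star_eq]
    simpa only [mul_assoc] using h.symm
  have hcomm := (hKsa j).commute_mul_self_of_isStarNormal_mul (hLsa i) hnormal
  rw [← hKT, ← hLS]
  exact hcomm.mul_right hcomm

end
end

section
/- (Beck's equivalence for general non-efficient measurements.) Let T₁, …, T_N be a finite discrete POVM on a complex Hilbert space H with Kraus decompositions: for each j a finite family of bounded operators K_{j,1}, …, K_{j,m_j} with ∑_{k=1}^{m_j} K_{j,k}† ∘ K_{j,k} = T_j. Let S be an effect on H. Then the following are equivalent: (i) K_{j,k} ∘ S = S ∘ K_{j,k} and K_{j,k}† ∘ S = S ∘ K_{j,k}† for all j, k; (ii) ∑_{j,k} K_{j,k}† ∘ S ∘ K_{j,k} = S and ∑_{j,k} K_{j,k}† ∘ S² ∘ K_{j,k} = S². -/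
set_option synthInstance.maxHeartbeats 1000000
set_option maxHeartbeats 1000000

noncomputable section

section StarSums

variable {A ι : Type*} [Fintype ι]

theorem eq_zero_of_sum_star_mul_self_eq_zero [NonUnitalCStarAlgebra A] [PartialOrder A]
    [StarOrderedRing A] {a : ι → A} (h : ∑ i, star (a i) * a i = 0) (i : ι) : a i = 0 := by
  rw [Finset.sum_eq_zero_iff_of_nonneg fun i _ => star_mul_self_nonneg (a i)] at h
  exact CStarRing.star_mul_self_eq_zero_iff (a i) |>.mp (h i (Finset.mem_univ i))

theorem sum_star_commutator_mul_commutator [Ring A] [StarRing A] (K : ι → A) {S : A}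
    (hS : IsSelfAdjoint S) :
    ∑ i, star (K i * S - S * K i) * (K i * S - S * K i) =
      S * (∑ i, star (K i) * K i) * S - S * (∑ i, star (K i) * S * K i)
        - (∑ i, star (K i) * S * K i) * S + ∑ i, star (K i) * (S * S) * K i := by
  simp only [Finset.mul_sum, Finset.sum_mul, ← Finset.sum_sub_distrib, ← Finset.sum_add_distrib]
  refine Finset.sum_congr rfl fun i _ => ?_
  rw [star_sub, star_mul, star_mul, hS.star_eq]
  noncomm_ring

/-- A self-adjoint element commutes with all Kraus elements and their adjoints iff it and its
square are fixed by the associated unital completely positive map. -/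
theorem forall_commute_iff_sum_star_mul_mul_eq [CStarAlgebra A] [PartialOrder A]
    [StarOrderedRing A] {K : ι → A} (hK : ∑ i, star (K i) * K i = 1) {S : A}
    (hS : IsSelfAdjoint S) :
    (∀ i, K i * S = S * K i ∧ star (K i) * S = S * star (K i)) ↔
      ∑ i, star (K i) * S * K i = S ∧ ∑ i, star (K i) * (S * S) * K i = S * S := by
  constructor
  · intro h
    have fixed (X : A) (hX : ∀ i, Commute (star (K i)) X) :
        ∑ i, star (K i) * X * K i = X := by
      simp_rw [(hX _).eq, mul_assoc, ← Finset.mul_sum, hK, mul_one]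
    have hc (i : ι) : Commute (star (K i)) S := (h i).2
    exact ⟨fixed S hc, fixed (S * S) fun i => (hc i).mul_right (hc i)⟩
  · rintro ⟨h₁, h₂⟩ i
    have hsum : ∑ i, star (K i * S - S * K i) * (K i * S - S * K i) = 0 := by
      rw [sum_star_commutator_mul_commutator K hS, hK, h₁, h₂]
      noncomm_ring
    have hcomm : K i * S = S * K i :=
      sub_eq_zero.mp (eq_zero_of_sum_star_mul_self_eq_zero hsum i)
    refine ⟨hcomm, ?_⟩
    simpa [hS.star_eq] using (congrArg star hcomm).symm

end StarSums

open ContinuousLinearMap in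
/-- **Beck's equivalence for general non-efficient measurements.** Let `T₁, …, T_N` be a
finite discrete POVM with Kraus decompositions `∑ k, (K j k)† (K j k) = T j`, and let `S`
be an effect. Then all Kraus operators, together with their adjoints, commute with `S`
iff the Heisenberg no-signaling identities hold for both `S` and `S²`. -/
theorem beck_equivalence_general_measurements
    {H : Type*} [NormedAddCommGroup H] [InnerProductSpace ℂ H] [CompleteSpace H]
    (N : ℕ) (T : Fin N → (H →L[ℂ] H))
    (hT0 : ∀ j, 0 ≤ T j) (hT1 : ∀ j, T j ≤ 1) (hTsum : ∑ j, T j = 1)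
    (m : Fin N → ℕ) (K : (j : Fin N) → Fin (m j) → (H →L[ℂ] H))
    (hKraus : ∀ j, ∑ k, adjoint (K j k) * K j k = T j)
    (S : H →L[ℂ] H) (hS0 : 0 ≤ S) (hS1 : S ≤ 1) :
    ((∀ j, ∀ k, K j k * S = S * K j k ∧ adjoint (K j k) * S = S * adjoint (K j k)) ↔
      ((∑ j, ∑ k, adjoint (K j k) * S * K j k) = S ∧
       (∑ j, ∑ k, adjoint (K j k) * (S * S) * K j k) = S * S)) := by
  have hK : ∑ p : (j : Fin N) × Fin (m j), star (K p.1 p.2) * K p.1 p.2 = 1 := by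
    rw [Fintype.sum_sigma, ← hTsum]
    exact Finset.sum_congr rfl fun j _ => hKraus j
  have key := forall_commute_iff_sum_star_mul_mul_eq hK (IsSelfAdjoint.of_nonneg hS0)
  rw [Fintype.sum_sigma, Fintype.sum_sigma, Sigma.forall] at key
  exact key

end
end

section
/- (Conditional effect with an isometry.) Let A and A₀ be bounded operators on a complex Hilbert space H with 0 ≤ A ≤ A₀ ≤ 1 and A₀ injective, let V : H → H be a linear isometry with adjoint V†, and let P = V ∘ V† (the orthogonal projection onto the range of V). Then there exists a unique bounded operator B on H such that P ∘ B ∘ P = B and A = √A₀ ∘ V† ∘ B ∘ V ∘ √A₀. Moreover 0 ≤ B ≤ 1 (indeed B ≤ P), and if A = A₀ then B = P. -/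
set_option synthInstance.maxHeartbeats 1000000
set_option maxHeartbeats 1000000

noncomputable section

namespace ContinuousLinearMap

open scoped ComplexOrder

variable {H : Type*} [NormedAddCommGroup H] [InnerProductSpace ℂ H] [CompleteSpace H]

/-- Positivity of a compression `T† D T` by an operator with dense range gives positivity
of `D`. -/
theorem nonneg_of_star_conj_nonneg {T D : H →L[ℂ] H} (hT : DenseRange T)
    (h : 0 ≤ star T * D * T) : 0 ≤ D := by
  rw [nonneg_iff_isPositive, ← isPositive_toLinearMap_iff, LinearMap.isPositive_iff_complex]
  have key : ∀ x, 0 ≤ inner ℂ (D x) x := by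
    intro x
    refine hT.induction_on (p := fun x => 0 ≤ inner ℂ (D x) x) x
      (isClosed_le continuous_const (by fun_prop)) fun y => ?_
    have := ((nonneg_iff_isPositive _).mp h).inner_nonneg_left y
    simpa [star_eq_adjoint, adjoint_inner_left] using this
  intro x
  have hx := Complex.nonneg_iff.mp (key x)
  exact ⟨Complex.ext rfl hx.2, hx.1⟩

/-- Compression by an operator with dense range reflects the order. -/
theorem le_of_star_conj_le {T C D : H →L[ℂ] H} (hT : DenseRange T)
    (h : star T * C * T ≤ star T * D * T) : C ≤ D := by
  rw [← sub_nonneg] at h ⊢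
  refine nonneg_of_star_conj_nonneg hT ?_
  rwa [mul_sub, sub_mul]

/-- Compression by an operator with dense range is injective. -/
theorem star_conj_injective {T : H →L[ℂ] H} (hT : DenseRange T) :
    Function.Injective fun D : H →L[ℂ] H => star T * D * T := fun _ _ h =>
  le_antisymm (le_of_star_conj_le hT h.le) (le_of_star_conj_le hT h.ge)

/-- **Douglas factorization**: if `R† R ≤ T† T` and `T` has dense range, then `R = K T` for some
bounded `K`. -/
theorem exists_mul_eq_of_star_mul_self_le {R T : H →L[ℂ] H} (hT : DenseRange T)
    (h : star R * R ≤ star T * T) : ∃ K : H →L[ℂ] H, K * T = R := by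
  have hnorm : ∀ x, ‖R x‖ ≤ 1 * ‖T x‖ := by
    intro x
    have hx := ((le_def _ _).mp h).re_inner_nonneg_left x
    have hx' : ‖R x‖ ^ 2 ≤ ‖T x‖ ^ 2 := by
      simpa [star_eq_adjoint, inner_sub_left, adjoint_inner_left, ← Complex.ofReal_pow] using hx
    rw [one_mul]
    exact (sq_le_sq₀ (norm_nonneg _) (norm_nonneg _)).mp hx'
  refine ⟨(R : H →ₗ[ℂ] H).extendOfNorm (T : H →ₗ[ℂ] H), ?_⟩
  ext x
  exact LinearMap.extendOfNorm_eq (f := (R : H →ₗ[ℂ] H)) (e := (T : H →ₗ[ℂ] H)) hT ⟨1, hnorm⟩ x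

/-- The square root of an injective positive operator has dense range. -/
theorem denseRange_sqrt_of_injective {A : H →L[ℂ] H} (hA : 0 ≤ A)
    (hinj : Function.Injective A) : DenseRange (CFC.sqrt A : H →L[ℂ] H) := by
  have hsq := CFC.sqrt_mul_sqrt_self A hA
  have hsa : adjoint (CFC.sqrt A) = CFC.sqrt A := IsSelfAdjoint.of_nonneg (CFC.sqrt_nonneg A)
  have hker : (CFC.sqrt A).ker = ⊥ := by
    refine LinearMap.ker_eq_bot.mpr fun x y hxy => hinj ?_
    rw [← hsq]
    exact congrArg (CFC.sqrt A : H →L[ℂ] H) hxy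
  have := (CFC.sqrt A).orthogonal_range
  rw [hsa, hker, ← Submodule.topologicalClosure_eq_top_iff] at this
  exact (Submodule.dense_iff_topologicalClosure_eq_top).mpr this

end ContinuousLinearMap

open ContinuousLinearMap in
/-- **Conditional effect with an isometry.** Let `0 ≤ A ≤ A₀ ≤ 1` with `A₀` injective,
let `V` be a linear isometry (`V† V = 1`) and `P = V V†` the orthogonal projection onto
the range of `V`. Then there is a unique bounded `B` with `P B P = B` and
`A = √A₀ V† B V √A₀`; moreover `0 ≤ B`, `B ≤ P` (hence `B ≤ 1`), and `B = P` if `A = A₀`. -/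
theorem conditional_effect_with_isometry
    {H : Type*} [NormedAddCommGroup H] [InnerProductSpace ℂ H] [CompleteSpace H]
    (A A₀ : H →L[ℂ] H)
    (hA : 0 ≤ A) (hAA₀ : A ≤ A₀) (hA₀1 : A₀ ≤ 1)
    (hinj : Function.Injective (A₀ : H → H))
    (V : H →L[ℂ] H) (hV : adjoint V * V = 1) :
    (∃! B : H →L[ℂ] H,
      (V * adjoint V) * B * (V * adjoint V) = B ∧
      A = CFC.sqrt A₀ * adjoint V * B * V * CFC.sqrt A₀) ∧
    (∀ B : H →L[ℂ] H,
      (V * adjoint V) * B * (V * adjoint V) = B →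
      A = CFC.sqrt A₀ * adjoint V * B * V * CFC.sqrt A₀ →
      0 ≤ B ∧ B ≤ V * adjoint V ∧ B ≤ 1 ∧ (A = A₀ → B = V * adjoint V)) := by
  rw [← star_eq_adjoint] at *
  have hA₀ : 0 ≤ A₀ := hA.trans hAA₀
  set S := CFC.sqrt A₀ with hS
  have hSd : DenseRange S := denseRange_sqrt_of_injective hA₀ hinj
  have hSS : S * S = A₀ := CFC.sqrt_mul_sqrt_self A₀ hA₀
  have hSs : star S = S := IsSelfAdjoint.of_nonneg (CFC.sqrt_nonneg A₀)
  have hP : V * star V ≤ 1 := by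
    have h := star_mul_self_nonneg (1 - V * star V)
    have h' : star (1 - V * star V) * (1 - V * star V) = 1 - V * star V := by
      have : V * star V * (V * star V) = V * star V := by
        rw [mul_assoc, ← mul_assoc (star V), hV, one_mul]
      simp [mul_sub, sub_mul, this]
    rwa [h', sub_nonneg] at h
  have hcompress : ∀ B, A = S * star V * B * V * S → star S * (star V * B * V) * S = A := by
    intro B hB
    rw [hB, hSs]
    simp only [mul_assoc]
  have hexpand : ∀ B, V * star V * B * (V * star V) = B → V * (star V * B * V) * star V = B := by
    intro B hB
    simpa only [mul_assoc] using hB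
  refine ⟨?_, fun B hPB hB => ?_⟩
  · obtain ⟨K, hK⟩ := exists_mul_eq_of_star_mul_self_le (R := CFC.sqrt A) (T := S) hSd (by
      rwa [hSs, hSS, (IsSelfAdjoint.of_nonneg (CFC.sqrt_nonneg A)).star_eq,
        CFC.sqrt_mul_sqrt_self A hA])
    have hKA : S * (star K * K) * S = A := by
      calc S * (star K * K) * S = star (K * S) * (K * S) := by
            simp only [star_mul, hSs, mul_assoc]
        _ = A := by
            rw [hK, (IsSelfAdjoint.of_nonneg (CFC.sqrt_nonneg A)).star_eq,
              CFC.sqrt_mul_sqrt_self A hA]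
    have hV' : ∀ X, star V * (V * X) = X := fun X => by rw [← mul_assoc, hV, one_mul]
    refine ⟨V * (star K * K) * star V, ⟨?_, ?_⟩, fun B hB => ?_⟩
    · simp only [mul_assoc, hV']
    · simp only [mul_assoc, hV'] at hKA ⊢
      exact hKA.symm
    · rw [← hexpand B hB.1]
      congr 2
      refine star_conj_injective hSd ?_
      simpa only [hSs, hKA] using hcompress B hB.2
  · have hD := hcompress B hB
    have h1 : star S * 1 * S = A₀ := by rw [mul_one, hSs, hSS]
    have hD0 : 0 ≤ star V * B * V := nonneg_of_star_conj_nonneg hSd (hD ▸ hA)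
    have hD1 : star V * B * V ≤ 1 := le_of_star_conj_le hSd (by rwa [hD, h1])
    have hBP : B ≤ V * star V := by
      have h := star_right_conjugate_le_conjugate hD1 V
      rwa [hexpand B hPB, mul_one] at h
    refine ⟨?_, hBP, hBP.trans hP, fun hAeq => ?_⟩
    · have h := star_right_conjugate_nonneg hD0 V
      rwa [hexpand B hPB] at h
    · have hDone : star V * B * V = 1 := star_conj_injective hSd (by
        simp only [hD, h1, hAeq])
      rw [← hexpand B hPB, hDone, mul_one]

end
end

section
/- (Gentle measurement lemma, Winter.) Let H be a nontrivial finite-dimensional complex inner product space, let T be a positive operator on H, let ρ be a positive operator with tr ρ = 1, and let δ ≥ 0 be such that tr(Tρ) ≥ ‖T‖·(1 − δ) > 0, where ‖T‖ is the operator norm. Let σ = tr(Tρ)⁻¹ · (√T ∘ ρ ∘ √T). Then the trace norm of ρ − σ satisfies ‖ρ − σ‖₁ = tr √((ρ − σ)† ∘ (ρ − σ)) ≤ 2√δ + δ. -/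
set_option synthInstance.maxHeartbeats 1000000
set_option maxHeartbeats 1000000

noncomputable section

/-- The trace of a (continuous) linear operator. -/
def traceCLM {H : Type*} [NormedAddCommGroup H] [InnerProductSpace ℂ H]
    (T : H →L[ℂ] H) : ℂ :=
  LinearMap.trace ℂ H (T : H →ₗ[ℂ] H)

section TraceClass

open ContinuousLinearMap

variable {H : Type*} [NormedAddCommGroup H] [InnerProductSpace ℂ H]

lemma traceCLM_eq_sum_inner {ι : Type*} [Fintype ι] (b : OrthonormalBasis ι ℂ H) (S : H →L[ℂ] H) :
    traceCLM S = ∑ i, inner ℂ (b i) (S (b i)) :=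
  LinearMap.trace_eq_sum_inner _ b

lemma traceCLM_mul_comm (S T : H →L[ℂ] H) : traceCLM (S * T) = traceCLM (T * S) :=
  LinearMap.trace_mul_comm ℂ (S : H →ₗ[ℂ] H) (T : H →ₗ[ℂ] H)

lemma traceCLM_add (S T : H →L[ℂ] H) : traceCLM (S + T) = traceCLM S + traceCLM T := by
  simp [traceCLM]

lemma traceCLM_sub (S T : H →L[ℂ] H) : traceCLM (S - T) = traceCLM S - traceCLM T := by
  simp [traceCLM]

lemma traceCLM_smul (c : ℂ) (S : H →L[ℂ] H) : traceCLM (c • S) = c * traceCLM S := by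
  simp [traceCLM]

open scoped ComplexOrder in
lemma ofReal_smul_nonneg {c : ℝ} (hc : 0 ≤ c) {T : H →L[ℂ] H} (hT : 0 ≤ T) :
    0 ≤ (c : ℂ) • T :=
  (nonneg_iff_isPositive _).2 <|
    ((nonneg_iff_isPositive T).1 hT).smul_of_nonneg (Complex.zero_le_real.2 hc)

variable [FiniteDimensional ℂ H]

/-- The squared Hilbert–Schmidt norm. -/
def hilbertSchmidtSq (S : H →L[ℂ] H) : ℝ :=
  ∑ i, ‖S (stdOrthonormalBasis ℂ H i)‖ ^ 2

lemma inner_adjoint_mul (S T : H →L[ℂ] H) (x y : H) :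
    inner ℂ x ((adjoint S * T) y) = inner ℂ (S x) (T y) :=
  adjoint_inner_right S x (T y)

lemma inner_adjoint_mul_self (S : H →L[ℂ] H) (x : H) :
    inner ℂ x ((adjoint S * S) x) = ((‖S x‖ ^ 2 : ℝ) : ℂ) := by
  rw [inner_adjoint_mul, inner_self_eq_norm_sq_to_K]
  push_cast
  rfl

lemma traceCLM_adjoint_mul_self_eq_sum {ι : Type*} [Fintype ι] (b : OrthonormalBasis ι ℂ H)
    (S : H →L[ℂ] H) : traceCLM (adjoint S * S) = (∑ i, ‖S (b i)‖ ^ 2 : ℝ) := by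
  rw [traceCLM_eq_sum_inner b]
  push_cast
  refine Finset.sum_congr rfl fun i _ => ?_
  exact_mod_cast inner_adjoint_mul_self S (b i)

lemma traceCLM_adjoint_mul_self (S : H →L[ℂ] H) :
    traceCLM (adjoint S * S) = hilbertSchmidtSq S :=
  traceCLM_adjoint_mul_self_eq_sum _ S

lemma sum_norm_sq_eq_hilbertSchmidtSq {ι : Type*} [Fintype ι] (b : OrthonormalBasis ι ℂ H)
    (S : H →L[ℂ] H) : ∑ i, ‖S (b i)‖ ^ 2 = hilbertSchmidtSq S := by
  exact_mod_cast (traceCLM_adjoint_mul_self_eq_sum b S).symm.trans (traceCLM_adjoint_mul_self S)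

lemma hilbertSchmidtSq_mul_le {C : H →L[ℂ] H} (hC : ‖C‖ ≤ 1) (S : H →L[ℂ] H) :
    hilbertSchmidtSq (C * S) ≤ hilbertSchmidtSq S := by
  refine Finset.sum_le_sum fun i _ => ?_
  gcongr
  exact C.le_of_opNorm_le_of_le hC le_rfl |>.trans_eq (one_mul _)

lemma sum_norm_inner_mul_le {ι : Type*} [Fintype ι] (b : OrthonormalBasis ι ℂ H)
    (S T : H →L[ℂ] H) :
    ∑ i, ‖inner ℂ (b i) ((adjoint S * T) (b i))‖ ≤
      √(hilbertSchmidtSq S) * √(hilbertSchmidtSq T) := by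
  rw [← sum_norm_sq_eq_hilbertSchmidtSq b S, ← sum_norm_sq_eq_hilbertSchmidtSq b T]
  refine le_trans (Finset.sum_le_sum fun i _ => ?_) (Real.sum_mul_le_sqrt_mul_sqrt _ _ _)
  rw [inner_adjoint_mul]
  exact norm_inner_le_norm _ _

/-- The trace norm of a self-adjoint operator is bounded by the sum of the absolute values of
its diagonal entries in an eigenbasis. -/
lemma exists_traceNorm_le_sum_norm_inner {X : H →L[ℂ] H} (hX : IsSelfAdjoint X) :
    ∃ b : OrthonormalBasis (Fin (Module.finrank ℂ H)) ℂ H,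
      (traceCLM (CFC.sqrt (adjoint X * X))).re ≤ ∑ i, ‖inner ℂ (b i) (X (b i))‖ := by
  have hsym := hX.isSymmetric
  let b := hsym.eigenvectorBasis rfl
  refine ⟨b, ?_⟩
  rw [traceCLM_eq_sum_inner b, Complex.re_sum]
  refine Finset.sum_le_sum fun i _ => ?_
  set B := CFC.sqrt (adjoint X * X)
  have hB : adjoint B * B = adjoint X * X := by
    have h : IsSelfAdjoint B := (CFC.sqrt_nonneg _).isSelfAdjoint
    rw [h.adjoint_eq]
    exact CFC.sqrt_mul_sqrt_self _ (star_mul_self_nonneg X)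
  have hb : ‖b i‖ = 1 := b.orthonormal.1 i
  have hnorm : ‖B (b i)‖ = ‖X (b i)‖ := by
    have h := (inner_adjoint_mul_self B (b i)).symm.trans (hB ▸ inner_adjoint_mul_self X (b i))
    exact (sq_eq_sq₀ (norm_nonneg _) (norm_nonneg _)).1 (by exact_mod_cast h)
  have hXb : X (b i) = (hsym.eigenvalues rfl i : ℂ) • b i := hsym.apply_eigenvectorBasis rfl i
  calc (inner ℂ (b i) (B (b i))).re ≤ ‖b i‖ * ‖B (b i)‖ :=
        re_inner_le_norm (𝕜 := ℂ) _ _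
    _ = ‖X (b i)‖ := by rw [hnorm, hb, one_mul]
    _ = ‖inner ℂ (b i) (X (b i))‖ := by
      rw [hXb, inner_smul_right, norm_smul, norm_mul, inner_self_eq_norm_sq_to_K, hb]
      simp

lemma norm_sqrt_sq {T : H →L[ℂ] H} (hT : 0 ≤ T) : ‖CFC.sqrt T‖ ^ 2 = ‖T‖ := by
  have h : IsSelfAdjoint (CFC.sqrt T) := (CFC.sqrt_nonneg T).isSelfAdjoint
  rw [sq, ← CStarRing.norm_star_mul_self, h.star_eq, CFC.sqrt_mul_sqrt_self T hT]

lemma traceCLM_mul_self_mul {A ρ : H →L[ℂ] H} (hA : 0 ≤ A) (hρ : 0 ≤ ρ) :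
    traceCLM (A * A * ρ) = hilbertSchmidtSq (A * CFC.sqrt ρ) := by
  have hR : adjoint (CFC.sqrt ρ) = CFC.sqrt ρ := (CFC.sqrt_nonneg ρ).isSelfAdjoint.adjoint_eq
  have hadj : adjoint (A * CFC.sqrt ρ) = adjoint (CFC.sqrt ρ) * adjoint A := star_mul _ _
  rw [← traceCLM_adjoint_mul_self, hadj, hR, hA.isSelfAdjoint.adjoint_eq, mul_assoc (CFC.sqrt ρ),
    traceCLM_mul_comm (CFC.sqrt ρ), ← mul_assoc A A, mul_assoc (A * A),
    CFC.sqrt_mul_sqrt_self ρ hρ]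

/-- The gentle measurement estimate for an effect `A * A` with `0 ≤ A ≤ 1`, with success
probability `p`. -/
lemma traceNorm_sub_smul_le {A ρ : H →L[ℂ] H} (hA : 0 ≤ A) (hA1 : ‖A‖ ≤ 1) (hρ : 0 ≤ ρ)
    (hρtr : traceCLM ρ = 1) {p : ℝ} (hp : 0 < p) (hpA : traceCLM (A * A * ρ) = p) :
    (traceCLM (CFC.sqrt (adjoint (ρ - (p : ℂ)⁻¹ • (A * ρ * A)) *
      (ρ - (p : ℂ)⁻¹ • (A * ρ * A))))).re ≤ 2 * √(1 - p) + (1 - p) := by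
  set R := CFC.sqrt ρ
  set C := CFC.sqrt A
  have hR : adjoint R = R := (CFC.sqrt_nonneg ρ).isSelfAdjoint.adjoint_eq
  have hC : adjoint C = C := (CFC.sqrt_nonneg A).isSelfAdjoint.adjoint_eq
  have hA' : adjoint A = A := hA.isSelfAdjoint.adjoint_eq
  have hρ' : adjoint ρ = ρ := hρ.isSelfAdjoint.adjoint_eq
  have hRR : R * R = ρ := CFC.sqrt_mul_sqrt_self ρ hρ
  have hCC : C * C = A := CFC.sqrt_mul_sqrt_self A hA
  have hadj (S T : H →L[ℂ] H) : adjoint (S * T) = adjoint T * adjoint S := star_mul S T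
  have hadj1 : adjoint (1 - A) = 1 - A := by
    rw [map_sub, hA']
    congr 1
    exact star_one _
  have hC1 : ‖C‖ ≤ 1 := by
    have := norm_sqrt_sq hA
    exact (sq_le_one_iff₀ (norm_nonneg _)).1 (this.trans_le hA1)
  have hsR : hilbertSchmidtSq R = 1 := by
    have := traceCLM_adjoint_mul_self R
    rw [hR, hRR, hρtr] at this
    exact_mod_cast this.symm
  have hsAR : hilbertSchmidtSq (A * R) = p := by
    exact_mod_cast (traceCLM_mul_self_mul hA hρ).symm.trans hpA
  have hsRA : hilbertSchmidtSq (R * A) = p := by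
    have := traceCLM_adjoint_mul_self (R * A)
    rw [hadj, hR, hA', mul_assoc, traceCLM_mul_comm, ← mul_assoc R, hRR, mul_assoc,
      traceCLM_mul_comm, hpA] at this
    exact_mod_cast this.symm
  have hsCR : traceCLM (A * ρ) = hilbertSchmidtSq (C * R) := by
    rw [← traceCLM_adjoint_mul_self, hadj, hR, hC, mul_assoc R, ← mul_assoc C, hCC,
      traceCLM_mul_comm R, mul_assoc, hRR]
  have hp1 : p ≤ 1 := by
    rw [← hsAR, ← hsR]
    exact hilbertSchmidtSq_mul_le hA1 R
  have hpC : p ≤ hilbertSchmidtSq (C * R) := by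
    rw [← hsAR, ← hCC, mul_assoc]
    exact hilbertSchmidtSq_mul_le hC1 _
  have hsR1 : hilbertSchmidtSq (R * (1 - A)) ≤ 1 - p := by
    have := traceCLM_adjoint_mul_self (R * (1 - A))
    rw [hadj, hR, hadj1, mul_assoc, ← mul_assoc R, hRR, traceCLM_mul_comm,
      show ρ * (1 - A) * (1 - A) = ρ - ρ * A - ρ * A + ρ * (A * A) by noncomm_ring,
      traceCLM_add, traceCLM_sub, traceCLM_sub, traceCLM_mul_comm ρ A,
      traceCLM_mul_comm ρ (A * A), hρtr, hpA, hsCR] at this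
    have : 1 - hilbertSchmidtSq (C * R) - hilbertSchmidtSq (C * R) + p =
      hilbertSchmidtSq (R * (1 - A)) := by exact_mod_cast this
    linarith
  have hX : IsSelfAdjoint (ρ - (p : ℂ)⁻¹ • (A * ρ * A)) := by
    rw [isSelfAdjoint_iff', map_sub, hρ', map_smulₛₗ, hadj, hadj, hρ', hA', mul_assoc]
    simp
  obtain ⟨b, hb⟩ := exists_traceNorm_le_sum_norm_inner hX
  refine hb.trans ?_
  have hdecomp : ρ - (p : ℂ)⁻¹ • (A * ρ * A) = adjoint (R * (1 - A)) * R +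
      adjoint (R * A) * (R * (1 - A)) + (1 - (p : ℂ)⁻¹) • (adjoint (R * A) * (R * A)) := by
    rw [hadj, hadj, hadj1, hR, hA', mul_assoc (1 - A), hRR, mul_assoc A R, ← mul_assoc R R, hRR,
      mul_assoc A R, ← mul_assoc R R, hRR, sub_smul, one_smul, ← mul_assoc, ← mul_assoc]
    noncomm_ring
  have hcoef : ‖1 - (p : ℂ)⁻¹‖ * p = 1 - p := by
    have h : (1 - (p : ℂ)⁻¹) = ((1 - p⁻¹ : ℝ) : ℂ) := by push_cast; rfl
    have h' : 1 ≤ p⁻¹ := (one_le_inv₀ hp).2 hp1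
    rw [h, Complex.norm_real, Real.norm_eq_abs, abs_of_nonpos (by linarith)]
    field_simp
    ring
  calc ∑ i, ‖inner ℂ (b i) ((ρ - (p : ℂ)⁻¹ • (A * ρ * A)) (b i))‖
      ≤ ∑ i, (‖inner ℂ (b i) ((adjoint (R * (1 - A)) * R : H →L[ℂ] H) (b i))‖ +
          ‖inner ℂ (b i) ((adjoint (R * A) * (R * (1 - A)) : H →L[ℂ] H) (b i))‖ +
          ‖1 - (p : ℂ)⁻¹‖ * ‖inner ℂ (b i) ((adjoint (R * A) * (R * A) : H →L[ℂ] H) (b i))‖) := by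
        refine Finset.sum_le_sum fun i _ => ?_
        rw [hdecomp, add_apply, add_apply, smul_apply, inner_add_right, inner_add_right,
          inner_smul_right, ← norm_mul]
        exact norm_add₃_le
    _ ≤ √(hilbertSchmidtSq (R * (1 - A))) * √(hilbertSchmidtSq R) +
          √(hilbertSchmidtSq (R * A)) * √(hilbertSchmidtSq (R * (1 - A))) +
          ‖1 - (p : ℂ)⁻¹‖ * (√(hilbertSchmidtSq (R * A)) * √(hilbertSchmidtSq (R * A))) := by
        rw [Finset.sum_add_distrib, Finset.sum_add_distrib, ← Finset.mul_sum]
        gcongr <;> exact sum_norm_inner_mul_le b _ _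
    _ ≤ √(1 - p) * 1 + 1 * √(1 - p) + (1 - p) := by
        rw [hsR, hsRA, Real.sqrt_one, Real.mul_self_sqrt hp.le, hcoef]
        gcongr
        exact Real.sqrt_le_one.2 hp1
    _ = 2 * √(1 - p) + (1 - p) := by ring

end TraceClass

open ContinuousLinearMap in
/-- **Gentle measurement lemma (Winter).** If `T ≥ 0`, `ρ` is a state with
`tr(Tρ) ≥ ‖T‖(1 − δ) > 0`, and `σ = tr(Tρ)⁻¹ √T ρ √T` is the Lüders post-measurement
state, then the trace norm `‖ρ − σ‖₁ = tr √((ρ − σ)† (ρ − σ))` is at most `2√δ + δ`. -/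
theorem gentle_measurement_lemma
    {H : Type*} [NormedAddCommGroup H] [InnerProductSpace ℂ H]
    [FiniteDimensional ℂ H] [Nontrivial H]
    (T ρ : H →L[ℂ] H) (hT : 0 ≤ T) (hρ : 0 ≤ ρ) (hρtr : traceCLM ρ = 1)
    (δ : ℝ) (hδ : 0 ≤ δ)
    (h1 : ‖T‖ * (1 - δ) ≤ (traceCLM (T * ρ)).re)
    (h2 : 0 < ‖T‖ * (1 - δ))
    (σ : H →L[ℂ] H)
    (hσ : σ = (traceCLM (T * ρ))⁻¹ • (CFC.sqrt T * ρ * CFC.sqrt T)) :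
    (traceCLM (CFC.sqrt (adjoint (ρ - σ) * (ρ - σ)))).re ≤ 2 * Real.sqrt δ + δ := by
  have hTnn := norm_nonneg T
  have hTpos : 0 < ‖T‖ := hTnn.lt_of_ne fun h => by simp [← h] at h2
  have hT1 : 0 < 1 - δ := pos_of_mul_pos_right h2 hTnn
  set s : ℝ := √‖T‖
  have hs : 0 < s := Real.sqrt_pos.2 hTpos
  have hss : s * s = ‖T‖ := Real.mul_self_sqrt hTnn
  have hssC : (s : ℂ) * s = ‖T‖ := by exact_mod_cast hss
  have hsC : (s : ℂ) ≠ 0 := by exact_mod_cast hs.ne'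
  set Q := CFC.sqrt T
  have hQQ : Q * Q = T := CFC.sqrt_mul_sqrt_self T hT
  set A : H →L[ℂ] H := ((s⁻¹ : ℝ) : ℂ) • Q
  have hA : 0 ≤ A := ofReal_smul_nonneg (inv_nonneg.2 hs.le) (CFC.sqrt_nonneg T)
  have hA1 : ‖A‖ ≤ 1 := by
    have hQ : ‖Q‖ = s := by
      rw [← Real.sqrt_sq (norm_nonneg Q), norm_sqrt_sq hT]
    rw [norm_smul, hQ, Complex.norm_real, Real.norm_of_nonneg (inv_nonneg.2 hs.le),
      inv_mul_cancel₀ hs.ne']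
  have hAA : T = (‖T‖ : ℂ) • (A * A) := by
    rw [smul_mul_smul_comm, hQQ, smul_smul, ← hssC, Complex.ofReal_inv]
    field_simp
    simp
  have htr : traceCLM (T * ρ) = ‖T‖ * traceCLM (A * A * ρ) := by
    conv_lhs => rw [hAA]
    rw [smul_mul_assoc, traceCLM_smul]
  obtain ⟨p, hp⟩ : ∃ p : ℝ, traceCLM (A * A * ρ) = p := ⟨_, traceCLM_mul_self_mul hA hρ⟩
  rw [hp] at htr
  have hpδ : 1 - δ ≤ p := by
    rw [htr, ← Complex.ofReal_mul, Complex.ofReal_re] at h1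
    exact le_of_mul_le_mul_left h1 hTpos
  have hσA : σ = (p : ℂ)⁻¹ • (A * ρ * A) := by
    rw [hσ, htr, smul_mul_assoc, smul_mul_smul_comm, smul_smul, mul_inv, ← hssC, mul_inv,
      Complex.ofReal_inv]
    congr 1
    ring
  rw [hσA]
  refine (traceNorm_sub_smul_le hA hA1 hρ hρtr (hT1.trans_le hpδ) hp).trans ?_
  gcongr <;> linarith

end
end

section
/- (Causal separation under small timelike translations.) Work in ℝ⁴ = ℝ × ℝ³. Let Δ, Δ' ⊆ {0} × ℝ³ be sets such that ‖x̄' − ȳ‖ ≥ ε for all (0, x̄') ∈ Δ' and (0, ȳ) ∈ Δ, for some ε > 0, and let a = (a₀, ā) ∈ ℝ⁴ with a₀ > ‖ā‖. Then for every real t with 0 < t < ε/(a₀ + ‖ā‖), the translate Δ' + t·a is disjoint from J⁺(Δ) ∪ J⁻(Δ). -/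
noncomputable section

/-- Minkowski spacetime, identified with `ℝ × ℝ³`, points `x = (x₀, x̄)` with `x̄`
carrying the Euclidean norm. -/
abbrev Mink : Type := ℝ × EuclideanSpace ℝ (Fin 3)

/-- Causal future: `J⁺(Δ) = {p : ∃ q ∈ Δ, p₀ − q₀ ≥ ‖p̄ − q̄‖}`. -/
def Jplus (Δ : Set Mink) : Set Mink := {p | ∃ q ∈ Δ, ‖p.2 - q.2‖ ≤ p.1 - q.1}

/-- Causal past: `J⁻(Δ) = {p : ∃ q ∈ Δ, q₀ − p₀ ≥ ‖p̄ − q̄‖}`. -/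
def Jminus (Δ : Set Mink) : Set Mink := {p | ∃ q ∈ Δ, ‖p.2 - q.2‖ ≤ q.1 - p.1}

/-- **Causal separation under small timelike translations.** -/
theorem causally_separated_under_small_timelike_translation
    (Δ Δ' : Set Mink)
    (hΔ : Δ ⊆ {x : Mink | x.1 = 0}) (hΔ' : Δ' ⊆ {x : Mink | x.1 = 0})
    (ε : ℝ) (hε : 0 < ε)
    (hsep : ∀ p ∈ Δ', ∀ q ∈ Δ, ε ≤ ‖p.2 - q.2‖)
    (a : Mink) (ha : ‖a.2‖ < a.1)
    (t : ℝ) (ht0 : 0 < t) (ht : t < ε / (a.1 + ‖a.2‖)) :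
    Disjoint ((fun x => x + t • a) '' Δ') (Jplus Δ ∪ Jminus Δ) := by
  have hpos : 0 < a.1 + ‖a.2‖ := by linarith [norm_nonneg a.2]
  rw [lt_div_iff₀ hpos] at ht
  have hbound : ∀ x ∈ Δ', ∀ q ∈ Δ, t * a.1 < ‖(x + t • a).2 - q.2‖ := by
    intro x hx q hq
    have htri : ‖x.2 - q.2‖ ≤ ‖(x + t • a).2 - q.2‖ + ‖t • a.2‖ := by
      have heq : x.2 - q.2 = ((x + t • a).2 - q.2) - t • a.2 := by
        simp only [Prod.snd_add, Prod.smul_snd]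
        abel
      rw [heq]
      exact norm_sub_le _ _
    rw [norm_smul, Real.norm_of_nonneg ht0.le] at htri
    linarith [hsep x hx q hq]
  have hnonneg : 0 ≤ t * a.1 := mul_nonneg ht0.le ((norm_nonneg _).trans ha.le)
  rw [Set.disjoint_left]
  rintro _ ⟨x, hx, rfl⟩ hJ
  have hx0 : x.1 = 0 := hΔ' hx
  have htime : (x + t • a).1 = t * a.1 := by simp [hx0]
  rcases hJ with ⟨q, hq, h⟩ | ⟨q, hq, h⟩ <;>
  · have hq0 : q.1 = 0 := hΔ hq
    have hlt := hbound x hx q hq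
    dsimp only at h
    rw [htime, hq0] at h
    linarith

end
end

section
/- (Microcausality of projection-valued localizations satisfying the causal condition.) Work in ℝ⁴ = ℝ × ℝ³ and let H be a complex Hilbert space. Let A assign to every compact subset Δ of every constant-time plane Σ_s an orthogonal projection A(Δ) on H such that: (i) A(Δ) ∘ A(Δ') = 0 whenever Δ and Δ' are disjoint compact subsets of a common plane Σ_s; (ii) causal condition: A(Δ) ≤ A((J⁺(Δ) ∪ J⁻(Δ)) ∩ Σ_r) for every compact Δ ⊆ Σ_s and every r ∈ ℝ. Then for all compact Δ, Δ' ⊆ Σ_0 whose Euclidean distance is strictly positive and every future-directed timelike a ∈ ℝ⁴, there exists δ > 0 such that for every real t with |t| < δ one has A(Δ) ∘ A(Δ' + t·a) = 0 = A(Δ' + t·a) ∘ A(Δ); in particular A(Δ) and A(Δ' + t·a) commute. -/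
noncomputable section

/-- `u = (u₀, ū)` is future-directed timelike iff `u₀ > ‖ū‖`. -/
def IsFDTimelike (u : Mink) : Prop := ‖u.2‖ < u.1

/-- The constant-time 3-plane `Σ_s`. -/
def plane (s : ℝ) : Set Mink := {x : Mink | x.1 = s}

/-- For `Δ` in the plane `Σ_s`, the part of the causal influence region of `Δ` lying in `Σ_r` is
the closed `|r - s|`-thickening of `Δ`, moved to the time `r`. -/
lemma mem_influence_iff {Δ : Set Mink} {s r : ℝ} (hΔ : Δ ⊆ plane s) {p : Mink} :
    p ∈ (Jplus Δ ∪ Jminus Δ) ∩ plane r ↔ p.1 = r ∧ ∃ q ∈ Δ, ‖p.2 - q.2‖ ≤ |r - s| := by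
  constructor
  · rintro ⟨⟨q, hq, h⟩ | ⟨q, hq, h⟩, hp : p.1 = r⟩
    all_goals
      have hqs : q.1 = s := hΔ hq
      rw [hp, hqs] at h
      refine ⟨hp, q, hq, h.trans ?_⟩
    · exact le_abs_self _
    · exact abs_sub_comm r s ▸ le_abs_self _
  · rintro ⟨hp, q, hq, h⟩
    have hqs : q.1 = s := hΔ hq
    refine ⟨?_, hp⟩
    rcases le_total s r with hsr | hsr
    · rw [abs_of_nonneg (sub_nonneg.2 hsr), ← hp, ← hqs] at h
      exact Or.inl ⟨q, hq, h⟩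
    · rw [abs_of_nonpos (sub_nonpos.2 hsr), neg_sub, ← hp, ← hqs] at h
      exact Or.inr ⟨q, hq, h⟩

lemma isCompact_influence {Δ : Set Mink} {s : ℝ} (r : ℝ) (hc : IsCompact Δ) (hΔ : Δ ⊆ plane s) :
    IsCompact ((Jplus Δ ∪ Jminus Δ) ∩ plane r) := by
  have himage : (Jplus Δ ∪ Jminus Δ) ∩ plane r =
      (fun x : Mink × EuclideanSpace ℝ (Fin 3) => ((r, x.1.2 + x.2) : Mink)) ''
        (Δ ×ˢ Metric.closedBall 0 |r - s|) := by
    ext p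
    rw [mem_influence_iff hΔ]
    constructor
    · rintro ⟨hp, q, hq, h⟩
      exact ⟨(q, p.2 - q.2), ⟨hq, mem_closedBall_zero_iff.2 h⟩, Prod.ext hp.symm (by simp)⟩
    · rintro ⟨⟨q, v⟩, ⟨hq, hv⟩, rfl⟩
      exact ⟨rfl, q, hq, by simpa using hv⟩
  rw [himage]
  exact (hc.prod (isCompact_closedBall _ _)).image (by fun_prop)

lemma translate_subset_plane {Δ : Set Mink} (hΔ : Δ ⊆ plane 0) (a : Mink) :
    (fun x => x + a) '' Δ ⊆ plane a.1 := by
  rintro _ ⟨x, hx, rfl⟩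
  have hx0 : x.1 = 0 := hΔ hx
  simp [plane, hx0]

/-- If `Δ'` lies in `Σ₀` at distance at least `ε` from `Δ`, then a translate of `Δ'` by a vector `b`
with `|b₀| + ‖b̄‖ < ε` has no causal influence on `Δ` within `Σ₀`. -/
lemma disjoint_influence_translate {Δ Δ' : Set Mink} (hΔ' : Δ' ⊆ plane 0)
    {ε : ℝ} (hdist : ∀ p ∈ Δ, ∀ q ∈ Δ', ε ≤ dist p q) {b : Mink} (hb : |b.1| + ‖b.2‖ < ε) :
    Disjoint Δ ((Jplus ((fun x => x + b) '' Δ') ∪ Jminus ((fun x => x + b) '' Δ')) ∩ plane 0) := by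
  rw [Set.disjoint_left]
  intro p hp hpK
  rw [mem_influence_iff (translate_subset_plane hΔ' b), zero_sub, abs_neg] at hpK
  obtain ⟨hp0, _, ⟨q, hq, rfl⟩, h⟩ := hpK
  have hq0 : q.1 = 0 := hΔ' hq
  have hpq : dist p q = ‖p.2 - q.2‖ := by
    rw [Prod.dist_eq, hp0, hq0, dist_self, max_eq_right dist_nonneg, dist_eq_norm]
  have htri : ‖p.2 - q.2‖ ≤ ‖p.2 - (q + b).2‖ + ‖b.2‖ := by
    simpa [sub_add_eq_sub_sub] using norm_add_le (p.2 - q.2 - b.2) b.2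
  linarith [hdist p hp q hq]

/-- **Microcausality of projection-valued localizations satisfying the causal condition.** -/
theorem microcausality_of_projection_valued_causal_localization
    {H : Type*} [NormedAddCommGroup H] [InnerProductSpace ℂ H] [CompleteSpace H]
    (A : Set Mink → (H →L[ℂ] H))
    -- `A Δ` is an orthogonal projection for every compact subset of a plane:
    (h_proj : ∀ Δ : Set Mink, IsCompact Δ → (∃ s : ℝ, Δ ⊆ plane s) →
      IsSelfAdjoint (A Δ) ∧ IsIdempotentElem (A Δ))
    -- (i) orthogonality on disjoint compact subsets of a common plane:
    (h_orth : ∀ s : ℝ, ∀ Δ Δ' : Set Mink, IsCompact Δ → Δ ⊆ plane s →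
      IsCompact Δ' → Δ' ⊆ plane s → Disjoint Δ Δ' → A Δ * A Δ' = 0)
    -- (ii) causal condition:
    (h_causal : ∀ s r : ℝ, ∀ Δ : Set Mink, IsCompact Δ → Δ ⊆ plane s →
      A Δ ≤ A ((Jplus Δ ∪ Jminus Δ) ∩ plane r)) :
    ∀ Δ Δ' : Set Mink, IsCompact Δ → Δ ⊆ plane 0 → IsCompact Δ' → Δ' ⊆ plane 0 →
      (∃ ε > (0 : ℝ), ∀ p ∈ Δ, ∀ q ∈ Δ', ε ≤ dist p q) →
      ∀ a : Mink, IsFDTimelike a →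
      ∃ δ > (0 : ℝ), ∀ t : ℝ, |t| < δ →
        A Δ * A ((fun x => x + t • a) '' Δ') = 0 ∧
        A ((fun x => x + t • a) '' Δ') * A Δ = 0 ∧
        A Δ * A ((fun x => x + t • a) '' Δ') = A ((fun x => x + t • a) '' Δ') * A Δ := by
  rintro Δ Δ' hc hΔ hc' hΔ' ⟨ε, hε, hdist⟩ a ha
  have ha0 : 0 < a.1 := (norm_nonneg _).trans_lt ha
  have hpos : 0 < a.1 + ‖a.2‖ := by positivity
  refine ⟨ε / (a.1 + ‖a.2‖), by positivity, fun t ht => ?_⟩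
  have hsmall : |(t • a).1| + ‖(t • a).2‖ < ε := by
    rw [Prod.smul_fst, Prod.smul_snd, smul_eq_mul, abs_mul, norm_smul, Real.norm_eq_abs,
      abs_of_pos ha0, ← mul_add]
    exact (lt_div_iff₀ hpos).1 ht
  set T := (fun x => x + t • a) '' Δ'
  have hTc : IsCompact T := hc'.image (by fun_prop)
  have hTs : T ⊆ plane (t • a).1 := translate_subset_plane hΔ' _
  have hKc := isCompact_influence 0 hTc hTs
  have hpΔ := h_proj Δ hc ⟨0, hΔ⟩
  have hpT := h_proj T hTc ⟨_, hTs⟩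
  have hpK := h_proj _ hKc ⟨0, Set.inter_subset_right⟩
  have hKT := (IsStarProjection.le_iff_mul_eq_right ⟨hpT.2, hpT.1⟩ ⟨hpK.2, hpK.1⟩).1
    (h_causal _ 0 T hTc hTs)
  have horth := h_orth 0 Δ _ hc hΔ hKc Set.inter_subset_right
    (disjoint_influence_translate hΔ' hdist hsmall)
  have hzero : A Δ * A T = 0 := by
    rw [← hKT, ← mul_assoc, horth, zero_mul]
  have hzero' : A T * A Δ = 0 := by
    simpa [hpΔ.1.star_eq, hpT.1.star_eq] using congrArg star hzero
  exact ⟨hzero, hzero', hzero.trans hzero'.symm⟩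

end
end
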